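/- (Proposition 3(i).) Suppose 0 < q₀ ≤ (c₂ − c₁)/(l₂ − l₁) and 0 < χ ≤ χ*(q₀). Then v*_χ(q₀; (l₁, p₂)) = l₁ − c₁ for every p₂ ∈ [l₁ − c₁ + c₂, l₂], and sup{v*_χ(q₀; p) : p ∈ P̄ ∪ P²} = l₁ − c₁; in particular, every price list p with p₁ = l₁ and p₂ ≥ l₁ − c₁ + c₂ attains this supremum. -/

import Mathlib

open Set Filter
open scoped Classical

noncomputable section

/-- The cutoff posterior q̄(p). -/
def qBar (l₁ l₂ p₁ p₂ : ℝ) : ℝ :=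
  if l₂ - (l₂ - l₁) / l₁ * p₁ ≤ p₂ then (p₂ - l₁) / (l₂ - l₁) else (p₂ - p₁) / l₂

/-- The slope λ(p). -/
def lamP (c₁ c₂ l₁ l₂ p₁ p₂ : ℝ) : ℝ :=
  ((p₂ - c₂) - (p₁ - c₁)) / qBar l₁ l₂ p₁ p₂

/-- The credibility threshold χ̲(q₀; p). -/
def chiLo (l₁ l₂ p₁ p₂ q₀ : ℝ) : ℝ :=
  (qBar l₁ l₂ p₁ p₂ - q₀) / (qBar l₁ l₂ p₁ p₂ * (1 - q₀))

/-- The prior threshold q̲(χ; p). -/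
def qLo (l₁ l₂ p₁ p₂ χ : ℝ) : ℝ :=
  qBar l₁ l₂ p₁ p₂ * (1 - χ) / (1 - χ * qBar l₁ l₂ p₁ p₂)

/-- p = (p₁, p₂) is a price list. -/
def IsPriceList (c₁ c₂ l₁ l₂ p₁ p₂ : ℝ) : Prop :=
  c₁ ≤ p₁ ∧ p₁ ≤ l₁ ∧ c₂ ≤ p₂ ∧ p₂ ≤ l₂ ∧ p₁ ≤ p₂

/-- The expert's p-equilibrium value v*_χ(q₀; p) for p ∈ P̄ ∪ P². -/
def vStar (c₁ c₂ l₁ l₂ χ q₀ p₁ p₂ : ℝ) : ℝ :=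
  if qBar l₁ l₂ p₁ p₂ < q₀ then p₂ - c₂
  else if qLo l₁ l₂ p₁ p₂ χ ≤ q₀ then lamP c₁ c₂ l₁ l₂ p₁ p₂ * q₀ + (p₁ - c₁)
  else p₁ - c₁

/-- The credibility threshold χ*(q₀). -/
def chiStarF (c₁ c₂ l₁ l₂ q₀ : ℝ) : ℝ :=
  ((c₂ - c₁) - q₀ * (l₂ - l₁)) / ((1 - q₀) * (c₂ - c₁))

end
/-- The first branch of `qBar` always bounds it from below. -/
theorem div_sub_le_qBar {l₁ l₂ p₁ p₂ : ℝ} (hl₁ : 0 < l₁) (hl : l₁ < l₂) :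
    (p₂ - l₁) / (l₂ - l₁) ≤ qBar l₁ l₂ p₁ p₂ := by
  unfold qBar
  split_ifs with h
  · exact le_rfl
  · rw [not_le, div_mul_eq_mul_div, lt_sub_iff_add_lt, ← lt_sub_iff_add_lt', div_lt_iff₀ hl₁] at h
    rw [div_le_div_iff₀ (sub_pos.2 hl) (hl₁.trans hl)]
    linarith

theorem qBar_le_one {l₁ l₂ p₁ p₂ : ℝ} (hl₁ : 0 < l₁) (hl : l₁ < l₂) (hp₁ : 0 ≤ p₁)
    (hp₂ : p₂ ≤ l₂) : qBar l₁ l₂ p₁ p₂ ≤ 1 := by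
  unfold qBar
  split_ifs
  · rw [div_le_one (sub_pos.2 hl)]; linarith
  · rw [div_le_one (hl₁.trans hl)]; linarith

theorem qBar_left_eq {l₁ l₂ p₂ : ℝ} (hl₁ : 0 < l₁) (hp₂ : l₁ ≤ p₂) :
    qBar l₁ l₂ l₁ p₂ = (p₂ - l₁) / (l₂ - l₁) := by
  rw [qBar, if_pos]
  rw [div_mul_cancel₀ _ hl₁.ne']
  linarith

/-- If `χ` is at most the credibility threshold at `Q`, then a cutoff posterior whose prior
threshold is at most `q₀` cannot exceed `Q`. -/
theorem qBar_le_of_qLo_le {l₁ l₂ p₁ p₂ χ q₀ Q : ℝ} (hq₀ : 0 < q₀) (hχ : 0 < χ) (hχ₁ : χ < 1)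
    (hχQ : χ * ((1 - q₀) * Q) ≤ Q - q₀) (hle : qBar l₁ l₂ p₁ p₂ ≤ 1)
    (h : qLo l₁ l₂ p₁ p₂ χ ≤ q₀) : qBar l₁ l₂ p₁ p₂ ≤ Q := by
  have hden : 0 < 1 - χ * qBar l₁ l₂ p₁ p₂ := by nlinarith
  rw [qLo, div_le_iff₀ hden] at h
  nlinarith [mul_pos hχ hq₀]

/-- If the cutoff posterior is at least `q₀`, mixing is worth at most the profit on `p₂`. -/
theorem lamP_mul_add_le {c₁ c₂ l₁ l₂ p₁ p₂ q₀ : ℝ} (hq₀ : 0 < q₀)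
    (hp : p₁ - c₁ ≤ p₂ - c₂) (hq : q₀ ≤ qBar l₁ l₂ p₁ p₂) :
    lamP c₁ c₂ l₁ l₂ p₁ p₂ * q₀ + (p₁ - c₁) ≤ p₂ - c₂ := by
  have : lamP c₁ c₂ l₁ l₂ p₁ p₂ * q₀ ≤ (p₂ - c₂) - (p₁ - c₁) := by
    rw [lamP, div_mul_eq_mul_div, div_le_iff₀ (hq₀.trans_le hq)]
    exact mul_le_mul_of_nonneg_left hq (sub_nonneg.2 hp)
  linarith

/-- Proposition 3(i): if 0 < q₀ ≤ (c₂ − c₁)/(l₂ − l₁) and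
0 < χ ≤ χ*(q₀), then v*_χ(q₀; (l₁, p₂)) = l₁ − c₁ for every p₂ ∈ [l₁ − c₁ + c₂, l₂],
the supremum of v*_χ(q₀; ·) over P̄ ∪ P² equals l₁ − c₁ and is attained, and every price
list with p₁ = l₁ and p₂ ≥ l₁ − c₁ + c₂ attains it. -/
theorem prop3_part1
    (c₁ c₂ l₁ l₂ : ℝ) (hc₁ : 0 ≤ c₁) (hc : c₁ < c₂) (h₁ : c₁ < l₁) (h₂ : c₂ < l₂)
    (hs : l₁ - c₁ < l₂ - c₂)
    (q₀ χ : ℝ) (hq₀ : 0 < q₀) (hq₀' : q₀ ≤ (c₂ - c₁) / (l₂ - l₁))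
    (hχ : 0 < χ) (hχ' : χ ≤ chiStarF c₁ c₂ l₁ l₂ q₀) :
    (∀ p₂ ∈ Set.Icc (l₁ - c₁ + c₂) l₂, vStar c₁ c₂ l₁ l₂ χ q₀ l₁ p₂ = l₁ - c₁) ∧
    IsGreatest {e | ∃ p₁ p₂ : ℝ, IsPriceList c₁ c₂ l₁ l₂ p₁ p₂ ∧ p₁ - c₁ ≤ p₂ - c₂ ∧
      e = vStar c₁ c₂ l₁ l₂ χ q₀ p₁ p₂} (l₁ - c₁) ∧
    (∀ p₁ p₂ : ℝ, IsPriceList c₁ c₂ l₁ l₂ p₁ p₂ → p₁ = l₁ → l₁ - c₁ + c₂ ≤ p₂ →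
      vStar c₁ c₂ l₁ l₂ χ q₀ p₁ p₂ = l₁ - c₁) := by
  have hl₁ : 0 < l₁ := hc₁.trans_lt h₁
  have hl : 0 < l₂ - l₁ := by linarith
  have hl' : l₁ < l₂ := sub_pos.1 hl
  set Q := (c₂ - c₁) / (l₂ - l₁) with hQ
  have hQ₀ : 0 < Q := div_pos (sub_pos.2 hc) hl
  have hQ₁ : Q < 1 := by rw [hQ, div_lt_one hl]; linarith
  have hq₁ : 0 < 1 - q₀ := by linarith
  have hcQ : c₂ - c₁ = Q * (l₂ - l₁) := by rw [hQ, div_mul_cancel₀ _ hl.ne']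
  have hχQ : χ * ((1 - q₀) * Q) ≤ Q - q₀ := by
    rw [chiStarF, le_div_iff₀ (mul_pos hq₁ (sub_pos.2 hc)), hcQ] at hχ'
    refine le_of_mul_le_mul_right ?_ hl
    linarith
  have hq₀Q : q₀ < Q := by linarith [mul_pos hχ (mul_pos hq₁ hQ₀)]
  have hχ₁ : χ < 1 := by
    refine lt_of_mul_lt_mul_right ?_ (mul_pos hq₁ hQ₀).le
    nlinarith
  have profit_le : ∀ {p₁ p₂ : ℝ}, qBar l₁ l₂ p₁ p₂ ≤ Q → p₂ - c₂ ≤ l₁ - c₁ := by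
    intro p₁ p₂ h
    have := (div_sub_le_qBar hl₁ hl').trans h
    rw [hQ, div_le_div_iff_of_pos_right hl] at this
    linarith
  have value_eq : ∀ p₂ ∈ Set.Icc (l₁ - c₁ + c₂) l₂,
      vStar c₁ c₂ l₁ l₂ χ q₀ l₁ p₂ = l₁ - c₁ := by
    rintro p₂ ⟨hp, hp'⟩
    have hQle : Q ≤ qBar l₁ l₂ l₁ p₂ := by
      rw [qBar_left_eq hl₁ (by linarith), hQ, div_le_div_iff_of_pos_right hl]
      linarith
    rw [vStar, if_neg (hq₀Q.trans_le hQle).not_gt]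
    split_ifs with h
    · have := profit_le (qBar_le_of_qLo_le hq₀ hχ hχ₁ hχQ (qBar_le_one hl₁ hl' hl₁.le hp') h)
      rw [lamP, show (p₂ - c₂) - (l₁ - c₁) = 0 by linarith, zero_div, zero_mul, zero_add]
    · rfl
  refine ⟨value_eq, ⟨⟨l₁, l₂, ⟨h₁.le, le_rfl, h₂.le, le_rfl, hl'.le⟩, hs.le,
    (value_eq l₂ ⟨by linarith, le_rfl⟩).symm⟩, ?_⟩, ?_⟩
  · rintro _ ⟨p₁, p₂, ⟨hp₁, hp₁', -, hp₂, -⟩, hp, rfl⟩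
    unfold vStar
    split_ifs with h h'
    · exact profit_le (h.trans hq₀Q).le
    · exact (lamP_mul_add_le hq₀ hp (not_lt.1 h)).trans <| profit_le <|
        qBar_le_of_qLo_le hq₀ hχ hχ₁ hχQ (qBar_le_one hl₁ hl' (hc₁.trans hp₁) hp₂) h'
    · linarith
  · rintro p₁ p₂ ⟨-, -, -, hp₂, -⟩ rfl hp
    exact value_eq p₂ ⟨hp, hp₂⟩
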